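/- With P = k[x,y,z,w], Φ a degree-3 Macaulay inverse system, ann Φ containing no nonzero linear form, and the map p : P_1 → Hom_k(P_1,k), p(u)(v) = Φ(x·u·v), bijective, the ideal ann Φ is generated by the set {x²·u : u ∈ P_1 with Φ(x²·u) = 0} together with the six elements q − x·ℓ_q for q ∈ {y², yz, yw, z², zw, w²}, where ℓ_q ∈ P_1 is the unique linear form with Φ(x·ℓ_q·v) = Φ(q·v) for all v ∈ P_1. -/

import Mathlib

open MvPolynomial

noncomputable section

variable (k : Type*) [Field k]

/-- The annihilator ideal `ann Φ = {f : Φ(f·g) = 0 for all g}` of the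
linear functional `Φ`. -/
def annIdeal (Φ : MvPolynomial (Fin 4) k →ₗ[k] k) : Ideal (MvPolynomial (Fin 4) k) where
  carrier := {f | ∀ g, Φ (f * g) = 0}
  add_mem' := by
    intro a b ha hb g
    rw [add_mul, map_add, ha g, hb g, add_zero]
  zero_mem' := by intro g; simp
  smul_mem' := by
    intro c a ha g
    have h : c • a * g = a * (c * g) := by rw [smul_eq_mul]; ring
    rw [h]; exact ha (c * g)

/-- The Macaulay map `p : P₁ → Hom(P₁, k)`, `p(u)(v) = Φ(x·u·v)`. -/
def pMap (Φ : MvPolynomial (Fin 4) k →ₗ[k] k) :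
    homogeneousSubmodule (Fin 4) k 1 →ₗ[k]
      (homogeneousSubmodule (Fin 4) k 1 →ₗ[k] k) where
  toFun u :=
    { toFun := fun v => Φ (X 0 * u.1 * v.1)
      map_add' := fun v w => by simp [mul_add]
      map_smul' := fun c v => by simp [mul_smul_comm] }
  map_add' u u' := by
    ext v
    simp [add_mul, mul_add]
  map_smul' c u := by
    ext v
    simp [mul_smul_comm, smul_mul_assoc]

lemma aux_deg (Φ : MvPolynomial (Fin 4) k →ₗ[k] k)
    (hΦ : ∀ m : Fin 4 →₀ ℕ, (m.sum fun _ e => e) ≠ 3 → Φ (monomial m 1) = 0)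
    (n : ℕ) (hn : n ≠ 3) (f : MvPolynomial (Fin 4) k) (hf : f.IsHomogeneous n) : Φ f = 0 := by
  rw [f.as_sum, map_sum]
  refine Finset.sum_eq_zero fun m hm => ?_
  have h1 : m.degree = n := by
    have := hf (mem_support_iff.1 hm)
    exact (DFunLike.congr_fun Finsupp.degree_eq_weight_one m).trans this
  have h2 : monomial m (coeff m f) = (coeff m f) • monomial m (1 : k) := by
    rw [smul_monomial]; simp
  rw [h2, map_smul, hΦ m, smul_zero]
  intro h
  apply hn
  rw [← h1, ← h]
  rfl

lemma aux_span (I : Ideal (MvPolynomial (Fin 4) k))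
    (h : ∀ i j : Fin 4, ∃ m : MvPolynomial (Fin 4) k, m.IsHomogeneous 1 ∧ X i * X j - X 0 * m ∈ I)
    (u v : MvPolynomial (Fin 4) k) (hu : u.IsHomogeneous 1) (hv : v.IsHomogeneous 1) :
    ∃ m : MvPolynomial (Fin 4) k, m.IsHomogeneous 1 ∧ u * v - X 0 * m ∈ I := by
  rw [← mem_homogeneousSubmodule, homogeneousSubmodule_one_eq_span_X] at hu hv
  induction hu using Submodule.span_induction with
  | mem x hx =>
    obtain ⟨i, rfl⟩ := hx
    induction hv using Submodule.span_induction with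
    | mem x hx => obtain ⟨j, rfl⟩ := hx; exact h i j
    | zero => exact ⟨0, isHomogeneous_zero _ _ _, by simp⟩
    | add x y _ _ hx hy =>
      obtain ⟨m, hm, h1⟩ := hx
      obtain ⟨m', hm', h2⟩ := hy
      exact ⟨m + m', hm.add hm', by convert I.add_mem h1 h2 using 1; ring⟩
    | smul a x _ hx =>
      obtain ⟨m, hm, h1⟩ := hx
      exact ⟨C a * m, by simpa using (isHomogeneous_C (Fin 4) a).mul hm, by
        convert I.mul_mem_left (C a) h1 using 1; rw [smul_eq_C_mul]; ring⟩
  | zero => exact ⟨0, isHomogeneous_zero _ _ _, by simp⟩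
  | add x y _ _ hx hy =>
    obtain ⟨m, hm, h1⟩ := hx
    obtain ⟨m', hm', h2⟩ := hy
    exact ⟨m + m', hm.add hm', by convert I.add_mem h1 h2 using 1; ring⟩
  | smul a x _ hx =>
    obtain ⟨m, hm, h1⟩ := hx
    exact ⟨C a * m, by simpa using (isHomogeneous_C (Fin 4) a).mul hm, by
      convert I.mul_mem_left (C a) h1 using 1; rw [smul_eq_C_mul]; ring⟩

lemma aux_ann (Φ : MvPolynomial (Fin 4) k →ₗ[k] k)
    (hΦ : ∀ m : Fin 4 →₀ ℕ, (m.sum fun _ e => e) ≠ 3 → Φ (monomial m 1) = 0)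
    (n r : ℕ) (hnr : n + r = 3) (f : MvPolynomial (Fin 4) k) (hf : f.IsHomogeneous n)
    (h : ∀ v : MvPolynomial (Fin 4) k, v.IsHomogeneous r → Φ (f * v) = 0) :
    f ∈ annIdeal k Φ := by
  intro g
  rw [← sum_homogeneousComponent g, Finset.mul_sum, map_sum]
  refine Finset.sum_eq_zero fun i _ => ?_
  by_cases hi : i = r
  · subst hi; exact h _ (homogeneousComponent_isHomogeneous _ _)
  · exact aux_deg k Φ hΦ (n + i) (by omega) _ (hf.mul (homogeneousComponent_isHomogeneous _ _))

lemma aux_main (Φ : MvPolynomial (Fin 4) k →ₗ[k] k)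
    (hΦ : ∀ m : Fin 4 →₀ ℕ, (m.sum fun _ e => e) ≠ 3 → Φ (monomial m 1) = 0)
    (hp : ∀ u : MvPolynomial (Fin 4) k, u.IsHomogeneous 1 →
      (∀ v : MvPolynomial (Fin 4) k, v.IsHomogeneous 1 → Φ (X 0 * u * v) = 0) → u = 0)
    (I : Ideal (MvPolynomial (Fin 4) k)) (hI : I ≤ annIdeal k Φ)
    (h : ∀ i j : Fin 4, ∃ m : MvPolynomial (Fin 4) k, m.IsHomogeneous 1 ∧ X i * X j - X 0 * m ∈ I)
    (hK : ∀ u : MvPolynomial (Fin 4) k, u.IsHomogeneous 1 → Φ (X 0 ^ 2 * u) = 0 →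
      X 0 ^ 2 * u ∈ I) : annIdeal k Φ ≤ I := by
  have hΦI : ∀ f ∈ I, Φ f = 0 := fun f hf => by simpa using hI hf 1
  have hX : ∀ i, (X i : MvPolynomial (Fin 4) k).IsHomogeneous 1 := fun i => isHomogeneous_X _ _
  have hCm : ∀ (a : k) (n : ℕ) (u : MvPolynomial (Fin 4) k), u.IsHomogeneous n →
      (C a * u).IsHomogeneous n := fun a n u hu => by
    simpa using (isHomogeneous_C (Fin 4) a).mul hu
  have hΦC : ∀ (a : k) (u : MvPolynomial (Fin 4) k), Φ (C a * u) = a * Φ u := fun a u => by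
    rw [← smul_eq_C_mul, map_smul, smul_eq_mul]
  have hcanc : ∀ (a : k) (u : MvPolynomial (Fin 4) k), a ≠ 0 → C a * u ∈ I → u ∈ I := by
    intro a u ha hu
    have := I.mul_mem_left (C a⁻¹) hu
    rwa [← mul_assoc, ← C_mul, inv_mul_cancel₀ ha, C_1, one_mul] at this
  have hq := aux_span k I h
  -- proportionality in degree three
  have h3 : ∀ u v a b : MvPolynomial (Fin 4) k, u.IsHomogeneous 1 → v.IsHomogeneous 1 →
      a.IsHomogeneous 1 → b.IsHomogeneous 1 →
      C (Φ (X 0 * a * b)) * (X 0 * u * v) - C (Φ (X 0 * u * v)) * (X 0 * a * b) ∈ I := by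
    intro u v a b hu hv ha hb
    obtain ⟨m, hm, hm'⟩ := hq u v hu hv
    obtain ⟨n, hn, hn'⟩ := hq a b ha hb
    have e1 := I.mul_mem_left (X 0) hm'
    have e2 := I.mul_mem_left (X 0) hn'
    have f1 := hΦI _ e1
    have f2 := hΦI _ e2
    have g1 : Φ (X 0 * u * v) = Φ (X 0 ^ 2 * m) := by
      rw [← sub_eq_zero, ← map_sub, ← f1]; congr 1; ring
    have g2 : Φ (X 0 * a * b) = Φ (X 0 ^ 2 * n) := by
      rw [← sub_eq_zero, ← map_sub, ← f2]; congr 1; ring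
    set s := Φ (X 0 * a * b)
    set t := Φ (X 0 * u * v)
    have e3 : X 0 ^ 2 * (C s * m - C t * n) ∈ I := by
      apply hK _ ((hCm _ _ _ hm).sub (hCm _ _ _ hn))
      have : X 0 ^ 2 * (C s * m - C t * n) = C s * (X 0 ^ 2 * m) - C t * (X 0 ^ 2 * n) := by ring
      rw [this, map_sub, hΦC, hΦC, ← g1, ← g2]; ring
    convert I.add_mem e3 (I.sub_mem (I.mul_mem_left (C s) e1) (I.mul_mem_left (C t) e2)) using 1
    ring
  have hnd : ∀ a : MvPolynomial (Fin 4) k, a.IsHomogeneous 1 → a ≠ 0 →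
      ∃ b : MvPolynomial (Fin 4) k, b.IsHomogeneous 1 ∧ Φ (X 0 * a * b) ≠ 0 := by
    intro a ha h0
    by_contra hcon
    push Not at hcon
    exact h0 (hp a ha hcon)
  have h4 : ∀ u v w : MvPolynomial (Fin 4) k, u.IsHomogeneous 1 → v.IsHomogeneous 1 →
      w.IsHomogeneous 1 → X 0 * u * v * w ∈ I := by
    intro u v w hu hv hw
    obtain ⟨a, ha, ha0, haw⟩ : ∃ a : MvPolynomial (Fin 4) k, a.IsHomogeneous 1 ∧ a ≠ 0 ∧
        Φ (X 0 * w * a) = 0 := by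
      by_cases h0 : Φ (X 0 * w * X 0) = 0
      · exact ⟨X 0, hX 0, X_ne_zero _, h0⟩
      · refine ⟨C (Φ (X 0 * w * X 0)) * X 1 - C (Φ (X 0 * w * X 1)) * X 0,
          (hCm _ _ _ (hX 1)).sub (hCm _ _ _ (hX 0)), ?_, ?_⟩
        · intro hz
          have := congrArg (eval (fun i : Fin 4 => if i = 1 then (1 : k) else 0)) hz
          simp at this
          exact h0 this
        · have : X 0 * w * (C (Φ (X 0 * w * X 0)) * X 1 - C (Φ (X 0 * w * X 1)) * X 0)
            = C (Φ (X 0 * w * X 0)) * (X 0 * w * X 1) - C (Φ (X 0 * w * X 1)) * (X 0 * w * X 0) := by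
            ring
          rw [this, map_sub, hΦC, hΦC]; ring
    obtain ⟨b, hb, hab⟩ := hnd a ha ha0
    have e1 := h3 w a a b hw ha ha hb
    rw [haw, C_0, zero_mul, sub_zero] at e1
    have e1' := hcanc _ _ hab e1
    have e2 := h3 u v a b hu hv ha hb
    apply hcanc _ _ hab
    convert I.add_mem (I.mul_mem_right w e2)
      (I.mul_mem_left (C (Φ (X 0 * u * v)) * b) e1') using 1
    ring
  obtain ⟨b, hb, hab⟩ := hnd (X 0) (hX 0) (X_ne_zero _)
  set T := X 0 * X 0 * b with hT
  have hTh : T.IsHomogeneous 3 := ((hX 0).mul (hX 0)).mul hb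
  have hdec : ∀ f : MvPolynomial (Fin 4) k, ∃ (c e : k) (l m : MvPolynomial (Fin 4) k),
      l.IsHomogeneous 1 ∧ m.IsHomogeneous 1 ∧ f - (C c + l + X 0 * m + C e * T) ∈ I := by
    intro f
    induction f using MvPolynomial.induction_on with
    | C a => exact ⟨a, 0, 0, 0, isHomogeneous_zero _ _ _, isHomogeneous_zero _ _ _, by simp⟩
    | add p q hp hq =>
      obtain ⟨c, e, l, m, hl, hm, hh⟩ := hp
      obtain ⟨c', e', l', m', hl', hm', hh'⟩ := hq
      refine ⟨c + c', e + e', l + l', m + m', hl.add hl', hm.add hm', ?_⟩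
      convert I.add_mem hh hh' using 1
      rw [C_add, C_add]; ring
    | mul_X p i ih =>
      obtain ⟨c, e, l, m, hl, hm, hh⟩ := ih
      obtain ⟨n, hn, hn'⟩ := hq l (X i) hl (hX i)
      have e3 := h3 m (X i) (X 0) b hm (hX i) (hX 0) hb
      have e4 := h4 (X 0) b (X i) (hX 0) hb (hX i)
      rw [← hT] at e3 e4
      refine ⟨0, Φ (X 0 * m * X i) / Φ T, C c * X i, n, hCm _ _ _ (hX i), hn, ?_⟩
      apply hcanc _ _ hab
      have hdiv : (C (Φ T) * C (Φ (X 0 * m * X i) / Φ T) : MvPolynomial (Fin 4) k)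
          = C (Φ (X 0 * m * X i)) := by
        rw [← C_mul, mul_div_cancel₀ _ hab]
      convert I.add_mem (I.add_mem (I.mul_mem_left (C (Φ T)) (I.mul_mem_right (X i) hh)) e3)
        (I.add_mem (I.mul_mem_left (C (Φ T) * C e) e4) (I.mul_mem_left (C (Φ T)) hn')) using 1
      rw [← hdiv, C_0]; ring
  intro f hf
  obtain ⟨c, e, l, m, hl, hm, hh⟩ := hdec f
  have hR : C c + l + X 0 * m + C e * T ∈ annIdeal k Φ := by
    have := (annIdeal k Φ).sub_mem hf (hI hh)
    simpa using this
  have hd := aux_deg k Φ hΦ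
  have hch : (C c : MvPolynomial (Fin 4) k).IsHomogeneous 0 := isHomogeneous_C _ _
  have he : e = 0 := by
    have := hR 1
    rw [mul_one, map_add, map_add, map_add, hd 0 (by omega) _ hch, hd 1 (by omega) _ hl,
      hd 2 (by omega) _ ((hX 0).mul hm), hΦC] at this
    simpa [hab] using this
  subst he
  have hm0 : m = 0 := by
    apply hp m hm
    intro v hv
    have := hR v
    rw [C_0, zero_mul, add_zero, add_mul, add_mul, map_add, map_add,
      hd 1 (by omega) _ (by simpa using hch.mul hv), hd 2 (by omega) _ (hl.mul hv)] at this
    simpa using this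
  subst hm0
  have hl0 : l = 0 := by
    apply hp l hl
    intro v hv
    have := hR (X 0 * v)
    rw [C_0, zero_mul, add_zero, mul_zero, add_zero, add_mul, map_add,
      hd 2 (by omega) _ (by simpa using hch.mul ((hX 0).mul hv)), zero_add] at this
    rw [← this]; congr 1; ring
  subst hl0
  have hc0 : c = 0 := by
    have := hR T
    rw [C_0, zero_mul, add_zero, mul_zero, add_zero, add_zero, hΦC] at this
    simpa [hab] using this
  subst hc0
  simpa using hh

/-- **Theorem 5.1** (first part).  Assume `Φ` is a degree-3 Macaulay inverse
system on `P = k[x,y,z,w]` whose annihilator contains no nonzero linear form,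
and that the map `p` is bijective.  Then `ann Φ` is generated by
`{x²·u : u ∈ P₁, Φ(x²·u) = 0}` together with the six elements `q − x·ℓ_q`,
`q ∈ {y², yz, yw, z², zw, w²}`, where `ℓ_q` is the unique linear form with
`Φ(x·ℓ_q·v) = Φ(q·v)` for all linear `v`. -/
theorem annIdeal_eq_span
    (Φ : MvPolynomial (Fin 4) k →ₗ[k] k)
    (hΦ : ∀ m : Fin 4 →₀ ℕ, (m.sum fun _ e => e) ≠ 3 → Φ (monomial m 1) = 0)
    (hlin : ∀ u ∈ homogeneousSubmodule (Fin 4) k 1, u ∈ annIdeal k Φ → u = 0)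
    (hp : Function.Bijective (pMap k Φ))
    (ly2 lyz lyw lz2 lzw lw2 : MvPolynomial (Fin 4) k)
    (hly2m : ly2 ∈ homogeneousSubmodule (Fin 4) k 1)
    (hlyzm : lyz ∈ homogeneousSubmodule (Fin 4) k 1)
    (hlywm : lyw ∈ homogeneousSubmodule (Fin 4) k 1)
    (hlz2m : lz2 ∈ homogeneousSubmodule (Fin 4) k 1)
    (hlzwm : lzw ∈ homogeneousSubmodule (Fin 4) k 1)
    (hlw2m : lw2 ∈ homogeneousSubmodule (Fin 4) k 1)
    (hly2 : ∀ v ∈ homogeneousSubmodule (Fin 4) k 1,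
      Φ (X 0 * ly2 * v) = Φ (X 1 ^ 2 * v))
    (hlyz : ∀ v ∈ homogeneousSubmodule (Fin 4) k 1,
      Φ (X 0 * lyz * v) = Φ (X 1 * X 2 * v))
    (hlyw : ∀ v ∈ homogeneousSubmodule (Fin 4) k 1,
      Φ (X 0 * lyw * v) = Φ (X 1 * X 3 * v))
    (hlz2 : ∀ v ∈ homogeneousSubmodule (Fin 4) k 1,
      Φ (X 0 * lz2 * v) = Φ (X 2 ^ 2 * v))
    (hlzw : ∀ v ∈ homogeneousSubmodule (Fin 4) k 1,
      Φ (X 0 * lzw * v) = Φ (X 2 * X 3 * v))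
    (hlw2 : ∀ v ∈ homogeneousSubmodule (Fin 4) k 1,
      Φ (X 0 * lw2 * v) = Φ (X 3 ^ 2 * v)) :
    annIdeal k Φ = Ideal.span
      ({g | ∃ u ∈ homogeneousSubmodule (Fin 4) k 1,
          Φ (X 0 ^ 2 * u) = 0 ∧ g = X 0 ^ 2 * u} ∪
        {X 1 ^ 2 - X 0 * ly2, X 1 * X 2 - X 0 * lyz, X 1 * X 3 - X 0 * lyw,
          X 2 ^ 2 - X 0 * lz2, X 2 * X 3 - X 0 * lzw, X 3 ^ 2 - X 0 * lw2}) := by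
  have hpi : ∀ u : MvPolynomial (Fin 4) k, u.IsHomogeneous 1 →
      (∀ v : MvPolynomial (Fin 4) k, v.IsHomogeneous 1 → Φ (X 0 * u * v) = 0) → u = 0 := by
    intro u hu hv
    have : (⟨u, hu⟩ : homogeneousSubmodule (Fin 4) k 1) = 0 := by
      apply hp.1
      rw [map_zero]
      ext v
      exact hv v.1 v.2
    exact congrArg Subtype.val this
  have hX : ∀ i, (X i : MvPolynomial (Fin 4) k).IsHomogeneous 1 := fun i => isHomogeneous_X _ _
  have key : ∀ (q l : MvPolynomial (Fin 4) k), q.IsHomogeneous 2 →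
      l ∈ homogeneousSubmodule (Fin 4) k 1 →
      (∀ v ∈ homogeneousSubmodule (Fin 4) k 1, Φ (X 0 * l * v) = Φ (q * v)) →
      q - X 0 * l ∈ annIdeal k Φ := by
    intro q l hq hl hv
    refine aux_ann k Φ hΦ 2 1 rfl _ (hq.sub ((hX 0).mul hl)) fun v hv' => ?_
    rw [sub_mul, map_sub, hv v hv', sub_self]
  have hle : Ideal.span
      ({g | ∃ u ∈ homogeneousSubmodule (Fin 4) k 1,
          Φ (X 0 ^ 2 * u) = 0 ∧ g = X 0 ^ 2 * u} ∪
        {X 1 ^ 2 - X 0 * ly2, X 1 * X 2 - X 0 * lyz, X 1 * X 3 - X 0 * lyw,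
          X 2 ^ 2 - X 0 * lz2, X 2 * X 3 - X 0 * lzw, X 3 ^ 2 - X 0 * lw2}) ≤ annIdeal k Φ := by
    rw [Ideal.span_le]
    rintro g (⟨u, hu, h0, rfl⟩ | hg)
    · refine aux_ann k Φ hΦ 3 0 rfl _ (((hX 0).pow 2).mul hu) fun v hv => ?_
      obtain ⟨c, rfl⟩ : ∃ c, v = C c :=
        ⟨_, totalDegree_eq_zero_iff_eq_C.1 ((totalDegree_zero_iff_isHomogeneous _).2 hv)⟩
      rw [mul_comm, ← smul_eq_C_mul, map_smul, h0, smul_zero]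
    · simp only [Set.mem_insert_iff, Set.mem_singleton_iff] at hg
      rcases hg with rfl | rfl | rfl | rfl | rfl | rfl
      · exact key _ _ ((hX 1).pow 2) hly2m hly2
      · exact key _ _ ((hX 1).mul (hX 2)) hlyzm hlyz
      · exact key _ _ ((hX 1).mul (hX 3)) hlywm hlyw
      · exact key _ _ ((hX 2).pow 2) hlz2m hlz2
      · exact key _ _ ((hX 2).mul (hX 3)) hlzwm hlzw
      · exact key _ _ ((hX 3).pow 2) hlw2m hlw2
  apply le_antisymm
  · apply aux_main k Φ hΦ hpi
    · exact hle
    · have hsym : ∀ i j : Fin 4, i ≤ j → ∃ m : MvPolynomial (Fin 4) k, m.IsHomogeneous 1 ∧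
          X i * X j - X 0 * m ∈ Ideal.span
            ({g | ∃ u ∈ homogeneousSubmodule (Fin 4) k 1,
                Φ (X 0 ^ 2 * u) = 0 ∧ g = X 0 ^ 2 * u} ∪
              {X 1 ^ 2 - X 0 * ly2, X 1 * X 2 - X 0 * lyz, X 1 * X 3 - X 0 * lyw,
                X 2 ^ 2 - X 0 * lz2, X 2 * X 3 - X 0 * lzw, X 3 ^ 2 - X 0 * lw2}) := by
        intro i j hij
        by_cases hi : i = 0
        · subst hi; exact ⟨X j, hX j, by simp⟩
        have hcases : (i = 1 ∧ j = 1) ∨ (i = 1 ∧ j = 2) ∨ (i = 1 ∧ j = 3) ∨ (i = 2 ∧ j = 2) ∨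
            (i = 2 ∧ j = 3) ∨ (i = 3 ∧ j = 3) := by
          revert i j; decide
        rcases hcases with ⟨rfl, rfl⟩ | ⟨rfl, rfl⟩ | ⟨rfl, rfl⟩ | ⟨rfl, rfl⟩ | ⟨rfl, rfl⟩ |
          ⟨rfl, rfl⟩
        · exact ⟨ly2, hly2m, Ideal.subset_span (Or.inr (by simp [← sq]))⟩
        · exact ⟨lyz, hlyzm, Ideal.subset_span (Or.inr (by simp))⟩
        · exact ⟨lyw, hlywm, Ideal.subset_span (Or.inr (by simp))⟩
        · exact ⟨lz2, hlz2m, Ideal.subset_span (Or.inr (by simp [← sq]))⟩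
        · exact ⟨lzw, hlzwm, Ideal.subset_span (Or.inr (by simp))⟩
        · exact ⟨lw2, hlw2m, Ideal.subset_span (Or.inr (by simp [← sq]))⟩
      intro i j
      rcases le_total i j with hij | hij
      · exact hsym i j hij
      · rw [mul_comm (X i) (X j)]; exact hsym j i hij
    · intro u hu h0
      exact Ideal.subset_span (Or.inl ⟨u, hu, h0, rfl⟩)
  · exact hle

end
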